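/- There exist constants c, C > 0 such that for all u₁ ∈ C³([0,1], ℂ) and u₂ ∈ C²([0,1], ℂ): c·E(u₁,u₂) ≤ 2∫₀¹ |u₁″(ρ)|² ρ⁵ dρ + 10∫₀¹ |u₁′(ρ)|² ρ³ dρ + 2∫₀¹ |u₂′(ρ)|² ρ⁵ dρ + |u₁(1)|² + |u₂(1)|² ≤ C·E(u₁,u₂), where E(u₁,u₂) := ∫₀¹ (|u₁(ρ)|² + |u₁′(ρ)|²) ρ⁵ dρ + ∫₀¹ |u₁″(ρ) + 5u₁′(ρ)/ρ|² ρ⁵ dρ + ∫₀¹ (|u₂(ρ)|² + |u₂′(ρ)|²) ρ⁵ dρ. -/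

import Mathlib

noncomputable section

open MeasureTheory

/-- The squared radial `H² × H¹` norm on the unit ball `B⁶₁`. -/
def sqRadialH2H1 (u₁ u₂ : ℝ → ℂ) : ℝ :=
  (∫ ρ in Set.Ioo (0:ℝ) 1, (‖u₁ ρ‖ ^ 2 + ‖deriv u₁ ρ‖ ^ 2) * ρ ^ 5)
  + (∫ ρ in Set.Ioo (0:ℝ) 1, ‖deriv (deriv u₁) ρ + 5 * deriv u₁ ρ / (ρ:ℂ)‖ ^ 2 * ρ ^ 5)
  + (∫ ρ in Set.Ioo (0:ℝ) 1, (‖u₂ ρ‖ ^ 2 + ‖deriv u₂ ρ‖ ^ 2) * ρ ^ 5)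

lemma aux_int {φ : ℝ → ℝ} (h : ContinuousOn φ (Set.Icc 0 1)) :
    IntegrableOn φ (Set.Ioo (0:ℝ) 1) :=
  (h.integrableOn_Icc).mono_set Set.Ioo_subset_Icc_self

lemma aux_parts {F G : ℝ → ℂ} (hF : ContinuousOn F (Set.Icc 0 1))
    (hG : ContinuousOn G (Set.Icc 0 1))
    (hd : ∀ x ∈ Set.Ioo (0:ℝ) 1, HasDerivAt F (G x) x) (n : ℕ) :
    2 * (∫ x in Set.Ioo (0:ℝ) 1, inner ℝ (F x) (G x) * x ^ (n+1))
      + (n+1) * (∫ x in Set.Ioo (0:ℝ) 1, ‖F x‖ ^ 2 * x ^ n) = ‖F 1‖ ^ 2 := by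
  have hi : ContinuousOn (fun x => inner ℝ (F x) (G x) * x ^ (n+1)) (Set.Icc (0:ℝ) 1) := by
    fun_prop
  have hs : ContinuousOn (fun x => ‖F x‖ ^ 2 * x ^ n) (Set.Icc (0:ℝ) 1) := by
    fun_prop
  have hc : ContinuousOn (fun x => ‖F x‖ ^ 2 * x ^ (n+1)) (Set.Icc (0:ℝ) 1) := by
    fun_prop
  have hci : ContinuousOn (fun x => 2 * (inner ℝ (F x) (G x) * x ^ (n+1))
      + (n+1) * (‖F x‖ ^ 2 * x ^ n)) (Set.Icc (0:ℝ) 1) := by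
    fun_prop
  have key := intervalIntegral.integral_eq_sub_of_hasDerivAt_of_le (zero_le_one' ℝ) hc
    (f' := fun x => 2 * (inner ℝ (F x) (G x) * x ^ (n+1)) + (n+1) * (‖F x‖ ^ 2 * x ^ n))
    (fun x hx => by
      have h1 := (hd x hx).norm_sq
      have h2 := hasDerivAt_pow (n+1) x
      refine (h1.mul h2).congr_deriv ?_
      push_cast
      ring)
    (ContinuousOn.intervalIntegrable_of_Icc zero_le_one hci)
  rw [intervalIntegral.integral_of_le zero_le_one, integral_Ioc_eq_integral_Ioo,
    integral_add ((aux_int hi).const_mul 2) ((aux_int hs).const_mul _),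
    integral_const_mul, integral_const_mul] at key
  rw [key]; simp

lemma aux_mono {φ ψ : ℝ → ℝ} (h : ContinuousOn φ (Set.Icc 0 1))
    (h' : ContinuousOn ψ (Set.Icc 0 1)) (hle : ∀ x ∈ Set.Ioo (0:ℝ) 1, φ x ≤ ψ x) :
    (∫ x in Set.Ioo (0:ℝ) 1, φ x) ≤ ∫ x in Set.Ioo (0:ℝ) 1, ψ x :=
  setIntegral_mono_on (aux_int h) (aux_int h') measurableSet_Ioo hle

lemma aux_add {φ ψ : ℝ → ℝ} (h : ContinuousOn φ (Set.Icc 0 1))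
    (h' : ContinuousOn ψ (Set.Icc 0 1)) (a b : ℝ) :
    (∫ x in Set.Ioo (0:ℝ) 1, (a * φ x + b * ψ x)) =
     a * (∫ x in Set.Ioo (0:ℝ) 1, φ x) + b * ∫ x in Set.Ioo (0:ℝ) 1, ψ x := by
  rw [integral_add ((aux_int h).const_mul _) ((aux_int h').const_mul _),
    integral_const_mul, integral_const_mul]

lemma aux_nonneg (F : ℝ → ℂ) (n : ℕ) :
    0 ≤ ∫ x in Set.Ioo (0:ℝ) 1, ‖F x‖ ^ 2 * x ^ n :=
  setIntegral_nonneg measurableSet_Ioo fun x hx => by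
    have := hx.1.le
    positivity

/-- trace and Poincare bounds -/
lemma aux_trace {F G : ℝ → ℂ} (hF : ContinuousOn F (Set.Icc 0 1))
    (hG : ContinuousOn G (Set.Icc 0 1))
    (hd : ∀ x ∈ Set.Ioo (0:ℝ) 1, HasDerivAt F (G x) x) :
    ‖F 1‖ ^ 2 ≤ 7 * (∫ x in Set.Ioo (0:ℝ) 1, ‖F x‖ ^ 2 * x ^ 5)
        + (∫ x in Set.Ioo (0:ℝ) 1, ‖G x‖ ^ 2 * x ^ 5) ∧
    5 * (∫ x in Set.Ioo (0:ℝ) 1, ‖F x‖ ^ 2 * x ^ 5) ≤ ‖F 1‖ ^ 2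
        + (∫ x in Set.Ioo (0:ℝ) 1, ‖G x‖ ^ 2 * x ^ 5) := by
  have hp := aux_parts hF hG hd 5
  have hFc : ContinuousOn (fun x => ‖F x‖ ^ 2 * x ^ 5) (Set.Icc (0:ℝ) 1) := by fun_prop
  have hGc : ContinuousOn (fun x => ‖G x‖ ^ 2 * x ^ 5) (Set.Icc (0:ℝ) 1) := by fun_prop
  have hi : ContinuousOn (fun x => inner ℝ (F x) (G x) * x ^ (5+1)) (Set.Icc (0:ℝ) 1) := by
    fun_prop
  have hb : ∀ x ∈ Set.Ioo (0:ℝ) 1, |inner ℝ (F x) (G x) * x ^ (5+1)| ≤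
      (1/2) * (‖F x‖ ^ 2 * x ^ 5) + (1/2) * (‖G x‖ ^ 2 * x ^ 5) := by
    intro x hx
    have h0 := hx.1.le
    have h5 : (0:ℝ) ≤ x ^ 5 := by positivity
    have h6 : x ^ (5+1) ≤ x ^ 5 := pow_le_pow_of_le_one h0 hx.2.le (by norm_num)
    have h1 := abs_real_inner_le_norm (F x) (G x)
    rw [abs_mul, abs_of_nonneg (by positivity : (0:ℝ) ≤ x ^ (5+1))]
    calc |inner ℝ (F x) (G x)| * x ^ (5+1) ≤ (‖F x‖ * ‖G x‖) * x ^ 5 := by gcongr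
      _ ≤ ((1/2) * ‖F x‖^2 + (1/2) * ‖G x‖^2) * x ^ 5 := by
        gcongr
        nlinarith [sq_nonneg (‖F x‖ - ‖G x‖)]
      _ = _ := by ring
  have hu := aux_mono hi (by fun_prop) fun x hx => (abs_le.1 (hb x hx)).2
  have hl := aux_mono (by fun_prop) hi fun x hx => (abs_le.1 (hb x hx)).1
  rw [integral_neg] at hl
  rw [aux_add hFc hGc] at hu hl
  push_cast at hp
  constructor <;> linarith

lemma aux_deriv {u : ℝ → ℂ} {n : WithTop ℕ∞} (hu : ContDiffOn ℝ (n+1) u (Set.Icc 0 1)) :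
    ContDiffOn ℝ n (derivWithin u (Set.Icc 0 1)) (Set.Icc 0 1) ∧
    (∀ x ∈ Set.Ioo (0:ℝ) 1, HasDerivAt u (derivWithin u (Set.Icc 0 1) x) x) := by
  refine ⟨hu.derivWithin (uniqueDiffOn_Icc zero_lt_one) le_rfl, fun x hx => ?_⟩
  have hd : DifferentiableOn ℝ u (Set.Icc 0 1) := hu.differentiableOn (by simp)
  exact ((hd x (Set.Ioo_subset_Icc_self hx)).hasDerivWithinAt).hasDerivAt
    (Icc_mem_nhds hx.1 hx.2)

/-- Equivalence of the alternative inner-product norm `‖·‖_{H̃}` (squared) with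
the radial `H² × H¹(B⁶₁)` norm (squared), uniformly over `u₁ ∈ C³([0,1],ℂ)` and
`u₂ ∈ C²([0,1],ℂ)`. -/
theorem tilde_norm_equivalence :
    ∃ c > (0:ℝ), ∃ C > (0:ℝ), ∀ u₁ u₂ : ℝ → ℂ,
      ContDiffOn ℝ 3 u₁ (Set.Icc 0 1) → ContDiffOn ℝ 2 u₂ (Set.Icc 0 1) →
      c * sqRadialH2H1 u₁ u₂ ≤
        2 * (∫ ρ in Set.Ioo (0:ℝ) 1, ‖deriv (deriv u₁) ρ‖ ^ 2 * ρ ^ 5)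
          + 10 * (∫ ρ in Set.Ioo (0:ℝ) 1, ‖deriv u₁ ρ‖ ^ 2 * ρ ^ 3)
          + 2 * (∫ ρ in Set.Ioo (0:ℝ) 1, ‖deriv u₂ ρ‖ ^ 2 * ρ ^ 5)
          + ‖u₁ 1‖ ^ 2 + ‖u₂ 1‖ ^ 2
      ∧ 2 * (∫ ρ in Set.Ioo (0:ℝ) 1, ‖deriv (deriv u₁) ρ‖ ^ 2 * ρ ^ 5)
          + 10 * (∫ ρ in Set.Ioo (0:ℝ) 1, ‖deriv u₁ ρ‖ ^ 2 * ρ ^ 3)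
          + 2 * (∫ ρ in Set.Ioo (0:ℝ) 1, ‖deriv u₂ ρ‖ ^ 2 * ρ ^ 5)
          + ‖u₁ 1‖ ^ 2 + ‖u₂ 1‖ ^ 2 ≤
        C * sqRadialH2H1 u₁ u₂ := by
  refine ⟨1/100, by norm_num, 10, by norm_num, fun u₁ u₂ hu₁ hu₂ => ?_⟩
  obtain ⟨hg, hd1⟩ := aux_deriv (n := 2) (by norm_num; exact hu₁)
  set g := derivWithin u₁ (Set.Icc 0 1)
  obtain ⟨hh, hd2⟩ := aux_deriv (n := 1) (by norm_num; exact hg)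
  set h := derivWithin g (Set.Icc 0 1)
  obtain ⟨hk, hd3⟩ := aux_deriv (n := 1) (by norm_num; exact hu₂)
  set k := derivWithin u₂ (Set.Icc 0 1)
  replace hu₁ := hu₁.continuousOn
  replace hu₂ := hu₂.continuousOn
  replace hg := hg.continuousOn
  replace hh := hh.continuousOn
  replace hk := hk.continuousOn
  have e1 : ∀ x ∈ Set.Ioo (0:ℝ) 1, deriv u₁ x = g x := fun x hx => (hd1 x hx).deriv
  have e3 : ∀ x ∈ Set.Ioo (0:ℝ) 1, deriv u₂ x = k x := fun x hx => (hd3 x hx).deriv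
  have e2 : ∀ x ∈ Set.Ioo (0:ℝ) 1, deriv (deriv u₁) x = h x := fun x hx => by
    rw [← (hd2 x hx).deriv]
    apply Filter.EventuallyEq.deriv_eq
    filter_upwards [isOpen_Ioo.mem_nhds hx] with y hy using e1 y hy
  have cU : ContinuousOn (fun x => ‖u₁ x‖ ^ 2 * x ^ 5) (Set.Icc (0:ℝ) 1) := by fun_prop
  have cB : ContinuousOn (fun x => ‖g x‖ ^ 2 * x ^ 5) (Set.Icc (0:ℝ) 1) := by fun_prop
  have cD : ContinuousOn (fun x => ‖g x‖ ^ 2 * x ^ 3) (Set.Icc (0:ℝ) 1) := by fun_prop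
  have cH : ContinuousOn (fun x => ‖h x‖ ^ 2 * x ^ 5) (Set.Icc (0:ℝ) 1) := by fun_prop
  have cV : ContinuousOn (fun x => ‖u₂ x‖ ^ 2 * x ^ 5) (Set.Icc (0:ℝ) 1) := by fun_prop
  have cK : ContinuousOn (fun x => ‖k x‖ ^ 2 * x ^ 5) (Set.Icc (0:ℝ) 1) := by fun_prop
  have cX : ContinuousOn (fun x => inner ℝ (g x) (h x) * x ^ (3+1)) (Set.Icc (0:ℝ) 1) := by
    fun_prop
  have i1 : (∫ ρ in Set.Ioo (0:ℝ) 1, ‖deriv (deriv u₁) ρ‖ ^ 2 * ρ ^ 5)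
      = ∫ x in Set.Ioo (0:ℝ) 1, ‖h x‖ ^ 2 * x ^ 5 :=
    setIntegral_congr_fun measurableSet_Ioo fun x hx => by simp only [e2 x hx]
  have i2 : (∫ ρ in Set.Ioo (0:ℝ) 1, ‖deriv u₁ ρ‖ ^ 2 * ρ ^ 3)
      = ∫ x in Set.Ioo (0:ℝ) 1, ‖g x‖ ^ 2 * x ^ 3 :=
    setIntegral_congr_fun measurableSet_Ioo fun x hx => by simp only [e1 x hx]
  have i3 : (∫ ρ in Set.Ioo (0:ℝ) 1, ‖deriv u₂ ρ‖ ^ 2 * ρ ^ 5)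
      = ∫ x in Set.Ioo (0:ℝ) 1, ‖k x‖ ^ 2 * x ^ 5 :=
    setIntegral_congr_fun measurableSet_Ioo fun x hx => by simp only [e3 x hx]
  have i4 : (∫ ρ in Set.Ioo (0:ℝ) 1, (‖u₁ ρ‖ ^ 2 + ‖deriv u₁ ρ‖ ^ 2) * ρ ^ 5)
      = 1 * (∫ x in Set.Ioo (0:ℝ) 1, ‖u₁ x‖ ^ 2 * x ^ 5)
        + 1 * ∫ x in Set.Ioo (0:ℝ) 1, ‖g x‖ ^ 2 * x ^ 5 := by
    rw [← aux_add cU cB]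
    exact setIntegral_congr_fun measurableSet_Ioo fun x hx => by
      simp only [e1 x hx]; ring
  have i5 : (∫ ρ in Set.Ioo (0:ℝ) 1, (‖u₂ ρ‖ ^ 2 + ‖deriv u₂ ρ‖ ^ 2) * ρ ^ 5)
      = 1 * (∫ x in Set.Ioo (0:ℝ) 1, ‖u₂ x‖ ^ 2 * x ^ 5)
        + 1 * ∫ x in Set.Ioo (0:ℝ) 1, ‖k x‖ ^ 2 * x ^ 5 := by
    rw [← aux_add cV cK]
    exact setIntegral_congr_fun measurableSet_Ioo fun x hx => by
      simp only [e3 x hx]; ring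
  have i6 : (∫ ρ in Set.Ioo (0:ℝ) 1,
        ‖deriv (deriv u₁) ρ + 5 * deriv u₁ ρ / (ρ:ℂ)‖ ^ 2 * ρ ^ 5)
      = 1 * (1 * (∫ x in Set.Ioo (0:ℝ) 1, ‖h x‖ ^ 2 * x ^ 5)
        + 25 * ∫ x in Set.Ioo (0:ℝ) 1, ‖g x‖ ^ 2 * x ^ 3)
        + 10 * ∫ x in Set.Ioo (0:ℝ) 1, inner ℝ (g x) (h x) * x ^ (3+1) := by
    rw [← aux_add cH cD, ← aux_add (by fun_prop) cX]
    refine setIntegral_congr_fun measurableSet_Ioo fun x hx => ?_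
    have hx0 : x ≠ 0 := hx.1.ne'
    have hr : h x + 5 * g x / (x:ℂ) = h x + (5 / x : ℝ) • g x := by
      rw [Complex.real_smul]; push_cast; ring
    simp only [e1 x hx, e2 x hx]
    rw [hr, norm_add_sq_real, inner_smul_right, norm_smul, real_inner_comm, mul_pow,
      Real.norm_eq_abs, sq_abs]
    field_simp
    ring
  have p := aux_parts hg hh hd2 3
  obtain ⟨t1, t2⟩ := aux_trace hu₁ hg hd1
  obtain ⟨t3, t4⟩ := aux_trace hu₂ hk hd3
  have m1 := aux_mono cB cD fun x hx =>
    mul_le_mul_of_nonneg_left (pow_le_pow_of_le_one hx.1.le hx.2.le (by norm_num)) (sq_nonneg _)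
  have m2 : 10 * (∫ x in Set.Ioo (0:ℝ) 1, inner ℝ (g x) (h x) * x ^ (3+1))
      ≤ 1 * (∫ x in Set.Ioo (0:ℝ) 1, ‖h x‖ ^ 2 * x ^ 5)
        + 25 * ∫ x in Set.Ioo (0:ℝ) 1, ‖g x‖ ^ 2 * x ^ 3 := by
    rw [← aux_add cH cD, ← integral_const_mul]
    refine aux_mono (by fun_prop) (by fun_prop) fun x hx => ?_
    have h1 := real_inner_le_norm (g x) (h x)
    have h0 := hx.1.le
    have h4 : (0:ℝ) ≤ x ^ 4 := by positivity
    have h3 : (0:ℝ) ≤ x ^ 3 := by positivity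
    have a1 := mul_le_mul_of_nonneg_right h1 h4
    have a2 := mul_nonneg h3 (sq_nonneg (‖h x‖ * x - 5 * ‖g x‖))
    have a3 : x ^ 3 * (‖h x‖ * x - 5 * ‖g x‖) ^ 2 = 1 * (‖h x‖ ^ 2 * x ^ 5)
        + 25 * (‖g x‖ ^ 2 * x ^ 3) - 10 * (‖g x‖ * ‖h x‖ * x ^ 4) := by ring
    have a4 : inner ℝ (g x) (h x) * x ^ (3+1) ≤ ‖g x‖ * ‖h x‖ * x ^ 4 := a1
    clear a1 h1
    generalize inner ℝ (g x) (h x) * x ^ (3+1) = w at *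
    linarith
  have n1 := aux_nonneg u₁ 5
  have n2 := aux_nonneg g 5
  have n3 := aux_nonneg g 3
  have n4 := aux_nonneg h 5
  have n5 := aux_nonneg u₂ 5
  have n6 := aux_nonneg k 5
  have s1 := sq_nonneg ‖u₁ 1‖
  have s2 := sq_nonneg ‖u₂ 1‖
  have s3 := sq_nonneg ‖g 1‖
  unfold sqRadialH2H1
  rw [i1, i2, i3, i4, i5, i6]
  push_cast at p
  constructor <;> linarith
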